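/- Let u be the m-bonacci word for an integer m ≥ 2. Then the minimum value of the abelian complexity of u equals m: ρ_u(n) ≥ m for every n ≥ 1, and ρ_u(1) = m. -/

import Mathlib

/-- The m-bonacci substitution on letters. -/
def mbSub (m : ℕ) (ℓ : ℕ) : List ℕ :=
  if ℓ = m - 1 then [0] else [0, ℓ + 1]

/-- Application of the m-bonacci substitution to a word. -/
def mbApply (m : ℕ) (w : List ℕ) : List ℕ := w.flatMap (mbSub m)

/-- σ_m^k(0). -/
def mbIter (m k : ℕ) : List ℕ := (mbApply m)^[k] [0]

/-- w is a factor of the m-bonacci word. -/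
def mbFactor (m : ℕ) (w : List ℕ) : Prop := ∃ k, w <:+: mbIter m k

/-- The prefix of length n of the m-bonacci word. -/
def mbPrefix (m n : ℕ) : List ℕ := (mbIter m n).take n

/-- Abelian complexity: number of distinct Parikh vectors of factors of length n. -/
noncomputable def mbAC (m n : ℕ) : ℕ :=
  Set.ncard ((fun (w : List ℕ) (ℓ : ℕ) => w.count ℓ) ''
    {w : List ℕ | mbFactor m w ∧ w.length = n})

/-- Tribonacci numbers. -/
def tribN : ℕ → ℕ
  | 0 => 0
  | 1 => 0
  | 2 => 1
  | n + 3 => tribN (n + 2) + tribN (n + 1) + tribN n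

/-- Value of a digit string (most significant digit first) in the Tribonacci system. -/
def valT : List ℕ → ℕ
  | [] => 0
  | d :: rest => d * tribN (rest.length + 3) + valT rest

/-- L is the normal T-representation of n (MSB first, greedy). -/
def IsNormalTRep (n : ℕ) (L : List ℕ) : Prop :=
  (∀ d ∈ L, d ≤ 1) ∧ (∀ d ∈ L.take 1, d = 1) ∧ valT L = n ∧
    ∀ S, S <:+ L → valT S < tribN (S.length + 3)

/-- Value of a digit string (MSB first) in the m-bonacci numeration system U_j = |σ_m^j(0)|. -/
def valU (m : ℕ) : List ℕ → ℕ
  | [] => 0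
  | d :: rest => d * (mbIter m rest.length).length + valU m rest

/-- L is the normal U-representation of n (MSB first, greedy) in the m-bonacci system. -/
def IsNormalURep (m n : ℕ) (L : List ℕ) : Prop :=
  (∀ d ∈ L, d ≤ 1) ∧ (∀ d ∈ L.take 1, d = 1) ∧ valU m L = n ∧
    ∀ S, S <:+ L → valU m S < (mbIter m S.length).length

theorem mbIter_succ (m k : ℕ) : mbIter m (k + 1) = mbApply m (mbIter m k) :=
  Function.iterate_succ_apply' _ _ _

theorem mbApply_append (m : ℕ) (v w : List ℕ) :
    mbApply m (v ++ w) = mbApply m v ++ mbApply m w :=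
  List.flatMap_append

theorem mbApply_cons (m ℓ : ℕ) (w : List ℕ) : mbApply m (ℓ :: w) = mbSub m ℓ ++ mbApply m w :=
  List.flatMap_cons

theorem exists_mbSub_eq_cons (m ℓ : ℕ) : ∃ t, mbSub m ℓ = 0 :: t := by
  unfold mbSub
  split_ifs <;> simp

theorem length_le_length_mbApply (m : ℕ) (w : List ℕ) : w.length ≤ (mbApply m w).length := by
  induction w with
  | nil => simp
  | cons ℓ w ih =>
    obtain ⟨t, ht⟩ := exists_mbSub_eq_cons m ℓ
    rw [mbApply_cons, ht]
    simp only [List.length_cons, List.length_append]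
    omega

theorem mbSub_zero {m : ℕ} (hm : 2 ≤ m) : mbSub m 0 = [0, 1] := by
  rw [mbSub, if_neg (by omega)]

theorem lt_length_mbIter {m : ℕ} (hm : 2 ≤ m) (k : ℕ) : k < (mbIter m k).length := by
  have h : ∃ t, mbIter m k = 0 :: t ∧ k ≤ t.length := by
    induction k with
    | zero => exact ⟨[], rfl, le_rfl⟩
    | succ k ih =>
      obtain ⟨t, ht, hk⟩ := ih
      refine ⟨1 :: mbApply m t, ?_, ?_⟩
      · rw [mbIter_succ, ht, mbApply_cons, mbSub_zero hm]
        rfl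
      · have := length_le_length_mbApply m t
        rw [List.length_cons]
        omega
  obtain ⟨t, ht, hk⟩ := h
  rw [ht, List.length_cons]
  omega

theorem mbFactor.of_infix {m : ℕ} {v w : List ℕ} (hw : mbFactor m w) (h : v <:+: w) :
    mbFactor m v :=
  hw.imp fun _ => h.trans

theorem mbFactor.mbApply {m : ℕ} {w : List ℕ} (hw : mbFactor m w) : mbFactor m (mbApply m w) := by
  obtain ⟨k, s, t, h⟩ := hw
  refine ⟨k + 1, _root_.mbApply m s, _root_.mbApply m t, ?_⟩
  rw [mbIter_succ, ← h, mbApply_append, mbApply_append]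

/-- The last letter of `σ_m(ℓ)` is `ℓ + 1`, or `0` when `ℓ = m - 1`. -/
theorem exists_mbSub_eq_concat (m ℓ : ℕ) :
    ∃ s, mbSub m ℓ = s ++ [if ℓ = m - 1 then 0 else ℓ + 1] := by
  unfold mbSub
  split_ifs
  · exact ⟨[], rfl⟩
  · exact ⟨[0], rfl⟩

theorem mbFactor.cons_mbApply {m ℓ : ℕ} {w : List ℕ} (h : mbFactor m (ℓ :: w)) :
    mbFactor m ((if ℓ = m - 1 then 0 else ℓ + 1) :: _root_.mbApply m w) := by
  obtain ⟨s, hs⟩ := exists_mbSub_eq_concat m ℓ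
  refine h.mbApply.of_infix ⟨s, [], ?_⟩
  rw [mbApply_cons, hs]
  simp

theorem mbFactor_succ_zero {m : ℕ} (hm : 2 ≤ m) {ℓ : ℕ} (hℓ : ℓ + 1 < m) :
    mbFactor m [ℓ + 1, 0] := by
  induction ℓ with
  | zero =>
    obtain ⟨t, ht⟩ := exists_mbSub_eq_cons m 1
    refine ⟨2, [0], t, ?_⟩
    rw [mbIter_succ, mbIter_succ]
    change _ = mbApply m (mbApply m [0])
    simp [mbApply, mbSub_zero hm, ht]
  | succ ℓ ih =>
    obtain ⟨t, ht⟩ := exists_mbSub_eq_cons m 0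
    have h := (ih (by omega)).cons_mbApply
    rw [if_neg (by omega), mbApply_cons, ht] at h
    exact h.of_infix ⟨[], t, by simp [mbApply]⟩

theorem mbFactor_cons_zero {m : ℕ} (hm : 2 ≤ m) {ℓ : ℕ} (hℓ : ℓ < m) : mbFactor m [ℓ, 0] := by
  cases ℓ with
  | succ ℓ => exact mbFactor_succ_zero hm hℓ
  | zero =>
    obtain ⟨j, rfl⟩ : ∃ j, m = j + 2 := ⟨m - 2, by omega⟩
    obtain ⟨t, ht⟩ := exists_mbSub_eq_cons (j + 2) 0
    have h := (mbFactor_succ_zero hm (ℓ := j) (by omega)).cons_mbApply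
    rw [if_pos (by omega), mbApply_cons, ht] at h
    exact h.of_infix ⟨[], t, by simp [mbApply]⟩

/-- Every prefix of the m-bonacci word can be extended to the left by every letter. -/
theorem mbFactor_cons_mbIter {m : ℕ} (hm : 2 ≤ m) (k : ℕ) {ℓ : ℕ} (hℓ : ℓ < m) :
    mbFactor m (ℓ :: mbIter m k) := by
  induction k generalizing ℓ with
  | zero => exact mbFactor_cons_zero hm hℓ
  | succ k ih =>
    rw [mbIter_succ]
    cases ℓ with
    | zero =>
      have h := (ih (ℓ := m - 1) (by omega)).cons_mbApply
      rwa [if_pos rfl] at h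
    | succ ℓ =>
      have h := (ih (ℓ := ℓ) (by omega)).cons_mbApply
      rwa [if_neg (by omega)] at h

theorem lt_of_mem_mbIter {m : ℕ} (hm : 2 ≤ m) (k : ℕ) : ∀ ℓ ∈ mbIter m k, ℓ < m := by
  induction k with
  | zero =>
    intro ℓ hℓ
    rw [mbIter, Function.iterate_zero_apply, List.mem_singleton] at hℓ
    omega
  | succ k ih =>
    intro ℓ hℓ
    rw [mbIter_succ, mbApply, List.mem_flatMap] at hℓ
    obtain ⟨a, ha, h⟩ := hℓ
    have := ih a ha
    unfold mbSub at h
    split_ifs at h <;> simp at h <;> omega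

theorem mbFactor.lt_of_mem {m : ℕ} (hm : 2 ≤ m) {w : List ℕ} (hw : mbFactor m w) :
    ∀ ℓ ∈ w, ℓ < m := by
  obtain ⟨k, h⟩ := hw
  exact fun ℓ hℓ => lt_of_mem_mbIter hm k ℓ (h.subset hℓ)

theorem finite_mbFactor_length_eq {m : ℕ} (hm : 2 ≤ m) (n : ℕ) :
    {w : List ℕ | mbFactor m w ∧ w.length = n}.Finite := by
  refine ((List.finite_length_eq (Fin m) n).image (List.map Fin.val)).subset ?_
  rintro w ⟨hw, hn⟩
  have h := hw.lt_of_mem hm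
  lift w to List (Fin m) using h
  exact ⟨w, by simpa using hn, rfl⟩

theorem injective_count_cons (w : List ℕ) :
    Function.Injective fun ℓ a : ℕ => (ℓ :: w).count a := by
  intro ℓ ℓ' h
  have h' := congrFun h ℓ
  by_contra hne
  simp [List.count_cons_of_ne (Ne.symm hne)] at h'

theorem le_mbAC {m n : ℕ} (hm : 2 ≤ m) (hn : 1 ≤ n) : m ≤ mbAC m n := by
  obtain ⟨n, rfl⟩ : ∃ j, n = j + 1 := ⟨n - 1, by omega⟩
  set w := mbPrefix m n
  have hlen : w.length = n := List.length_take_of_le (lt_length_mbIter hm n).le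
  calc m = ((fun ℓ a : ℕ => (ℓ :: w).count a) '' Set.Iio m).ncard := by
        rw [Set.ncard_image_of_injective _ (injective_count_cons w), ← Finset.coe_Iio,
          Set.ncard_coe_finset, Nat.card_Iio]
    _ ≤ mbAC m (n + 1) := by
        refine Set.ncard_le_ncard ?_ ((finite_mbFactor_length_eq hm _).image _)
        rintro _ ⟨ℓ, hℓ, rfl⟩
        refine ⟨ℓ :: w, ⟨(mbFactor_cons_mbIter hm n hℓ).of_infix ?_, by simp [hlen]⟩, rfl⟩
        exact (List.cons_prefix_cons.mpr ⟨rfl, List.take_prefix n _⟩).isInfix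

theorem mbAC_one_le {m : ℕ} (hm : 2 ≤ m) : mbAC m 1 ≤ m := by
  have hsub : {w : List ℕ | mbFactor m w ∧ w.length = 1} ⊆ (fun ℓ => [ℓ]) '' Set.Iio m := by
    rintro w ⟨hw, h1⟩
    obtain ⟨ℓ, rfl⟩ := List.length_eq_one_iff.mp h1
    exact ⟨ℓ, hw.lt_of_mem hm ℓ (by simp), rfl⟩
  have hfin : (Set.Iio m).Finite := Set.finite_Iio m
  calc mbAC m 1 ≤ {w : List ℕ | mbFactor m w ∧ w.length = 1}.ncard :=
        Set.ncard_image_le (finite_mbFactor_length_eq hm 1)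
    _ ≤ ((fun ℓ => [ℓ]) '' Set.Iio m).ncard := Set.ncard_le_ncard hsub (hfin.image _)
    _ ≤ (Set.Iio m).ncard := Set.ncard_image_le hfin
    _ = m := by rw [← Finset.coe_Iio, Set.ncard_coe_finset, Nat.card_Iio]

theorem mbonacci_abelian_complexity_min (m : ℕ) (hm : 2 ≤ m) :
    (∀ n : ℕ, 1 ≤ n → m ≤ mbAC m n) ∧ mbAC m 1 = m :=
  ⟨fun _ => le_mbAC hm, (mbAC_one_le hm).antisymm (le_mbAC hm le_rfl)⟩
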